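/- Let G be a simple graph on n vertices with matching number β, and let ρ(G) denote the largest eigenvalue of its adjacency matrix. If n = 3β + 2, then ρ(G) ≤ 2β, with equality if and only if G is isomorphic to the join K_β ∨ K̄_{n−β} or to the disjoint union K_{2β+1} ∪ K̄_{n−2β−1}. -/

import Mathlib

open scoped Classical

/-- The adjacency matrix of a graph, over ℝ. -/
noncomputable def adjMat {V : Type*} [Fintype V] (G : SimpleGraph V) : Matrix V V ℝ :=
  fun i j => if G.Adj i j then 1 else 0

/-- The diagonal matrix of vertex degrees, over ℝ. -/
noncomputable def degMat {V : Type*} [Fintype V] (G : SimpleGraph V) : Matrix V V ℝ :=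
  fun i j => if i = j then ((G.neighborSet i).ncard : ℝ) else 0

/-- The largest (real) eigenvalue of a matrix. -/
noncomputable def specRad {V : Type*} [Fintype V] (M : Matrix V V ℝ) : ℝ :=
  sSup {t : ℝ | ∃ v : V → ℝ, v ≠ 0 ∧ M.mulVec v = t • v}

/-- The α-spectral radius: the largest eigenvalue of A_α(G) = α·D(G) + A(G). -/
noncomputable def alphaRadius {V : Type*} [Fintype V] (α : ℝ) (G : SimpleGraph V) : ℝ :=
  specRad (α • degMat G + adjMat G)

/-- The matching number of a graph. -/
noncomputable def matchingNumber {V : Type*} [Fintype V] (G : SimpleGraph V) : ℕ :=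
  sSup {m : ℕ | ∃ M : G.Subgraph, M.IsMatching ∧ M.edgeSet.ncard = m}

/-- The join of two graphs. -/
def graphJoin {A B : Type*} (G : SimpleGraph A) (H : SimpleGraph B) : SimpleGraph (A ⊕ B) :=
  SimpleGraph.fromRel (fun x y => match x, y with
    | Sum.inl a, Sum.inl b => G.Adj a b
    | Sum.inr a, Sum.inr b => H.Adj a b
    | _, _ => True)

/-- The disjoint union of two graphs. -/
def graphSum {A B : Type*} (G : SimpleGraph A) (H : SimpleGraph B) : SimpleGraph (A ⊕ B) :=
  SimpleGraph.fromRel (fun x y => match x, y with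
    | Sum.inl a, Sum.inl b => G.Adj a b
    | Sum.inr a, Sum.inr b => H.Adj a b
    | _, _ => False)

/-- The number of odd components of G − S. -/
noncomputable def oddComponentsOutside {V : Type*} [Fintype V] (G : SimpleGraph V) (S : Set V) : ℕ :=
  Set.ncard {c : (G.induce Sᶜ).ConnectedComponent | Odd c.supp.ncard}

/-- The disjoint union of cliques K_{f 0} ∪ ⋯ ∪ K_{f (q-1)}. -/
def cliquesUnion (q : ℕ) (f : Fin q → ℕ) : SimpleGraph (Σ i : Fin q, Fin (f i)) :=
  SimpleGraph.fromRel (fun x y => x.1 = y.1)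

universe u

section TutteBerge

variable {V : Type*} {W : Type*}

@[simp]
theorem graphJoin_adj_inl_inl (G : SimpleGraph V) (H : SimpleGraph W) (a b : V) :
    (graphJoin G H).Adj (Sum.inl a) (Sum.inl b) ↔ G.Adj a b := by
  simp only [graphJoin, SimpleGraph.fromRel_adj, ne_eq, Sum.inl.injEq]
  exact ⟨fun h => h.2.elim id SimpleGraph.Adj.symm, fun h => ⟨h.ne, Or.inl h⟩⟩

@[simp]
theorem graphJoin_adj_inr_inr (G : SimpleGraph V) (H : SimpleGraph W) (a b : W) :
    (graphJoin G H).Adj (Sum.inr a) (Sum.inr b) ↔ H.Adj a b := by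
  simp only [graphJoin, SimpleGraph.fromRel_adj, ne_eq, Sum.inr.injEq]
  exact ⟨fun h => h.2.elim id SimpleGraph.Adj.symm, fun h => ⟨h.ne, Or.inl h⟩⟩

@[simp]
theorem graphJoin_adj_inl_inr (G : SimpleGraph V) (H : SimpleGraph W) (a : V) (b : W) :
    (graphJoin G H).Adj (Sum.inl a) (Sum.inr b) := by
  simp [graphJoin]

@[simp]
theorem graphJoin_adj_inr_inl (G : SimpleGraph V) (H : SimpleGraph W) (a : V) (b : W) :
    (graphJoin G H).Adj (Sum.inr b) (Sum.inl a) := by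
  simp [graphJoin]

@[simp]
theorem graphSum_adj_inl_inl (G : SimpleGraph V) (H : SimpleGraph W) (a b : V) :
    (graphSum G H).Adj (Sum.inl a) (Sum.inl b) ↔ G.Adj a b := by
  simp only [graphSum, SimpleGraph.fromRel_adj, ne_eq, Sum.inl.injEq]
  exact ⟨fun h => h.2.elim id SimpleGraph.Adj.symm, fun h => ⟨h.ne, Or.inl h⟩⟩

@[simp]
theorem graphSum_adj_inr_inr (G : SimpleGraph V) (H : SimpleGraph W) (a b : W) :
    (graphSum G H).Adj (Sum.inr a) (Sum.inr b) ↔ H.Adj a b := by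
  simp only [graphSum, SimpleGraph.fromRel_adj, ne_eq, Sum.inr.injEq]
  exact ⟨fun h => h.2.elim id SimpleGraph.Adj.symm, fun h => ⟨h.ne, Or.inl h⟩⟩

@[simp]
theorem not_graphSum_adj_inl_inr (G : SimpleGraph V) (H : SimpleGraph W) (a : V) (b : W) :
    ¬ (graphSum G H).Adj (Sum.inl a) (Sum.inr b) := by
  simp [graphSum]

@[simp]
theorem not_graphSum_adj_inr_inl (G : SimpleGraph V) (H : SimpleGraph W) (a : V) (b : W) :
    ¬ (graphSum G H).Adj (Sum.inr b) (Sum.inl a) := by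
  simp [graphSum]

theorem ncard_verts_le_of_isMatching [Fintype V] {G : SimpleGraph V} {M : G.Subgraph}
    (hM : M.IsMatching) : M.verts.ncard ≤ 2 * M.edgeSet.ncard := by
  have h : M.verts.toFinset ⊆ M.edgeSet.toFinset.biUnion fun e => e.toFinset := by
    intro v hv
    obtain ⟨w, hw, -⟩ := hM (Set.mem_toFinset.1 hv)
    simp only [Finset.mem_biUnion, Set.mem_toFinset]
    exact ⟨s(v, w), hw, by simp⟩
  rw [Set.ncard_eq_toFinset_card', Set.ncard_eq_toFinset_card', mul_comm]
  refine (Finset.card_le_card h).trans (Finset.card_biUnion_le_card_mul _ _ _ fun e _ => ?_)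
  rw [Sym2.card_toFinset]
  split_ifs <;> omega

theorem ncard_edgeSet_le_matchingNumber [Fintype V] {G : SimpleGraph V} {M : G.Subgraph}
    (hM : M.IsMatching) : M.edgeSet.ncard ≤ matchingNumber G := by
  refine le_csSup ⟨Nat.card (Sym2 V), ?_⟩ ⟨M, hM, rfl⟩
  rintro _ ⟨N, -, rfl⟩
  exact Set.ncard_le_card _

/-- A perfect matching of the join of `G` and `H` leaves at most `|H|` vertices of `G` unmatched
inside `G`. -/
theorem card_le_of_isPerfectMatching_graphJoin [Fintype V] [Fintype W] (G : SimpleGraph V)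
    (H : SimpleGraph W) {M : (graphJoin G H).Subgraph} (hM : M.IsPerfectMatching) :
    Fintype.card V ≤ 2 * matchingNumber G + Fintype.card W := by
  let N : G.Subgraph :=
    { verts := {v | ∃ w, M.Adj (Sum.inl v) (Sum.inl w)}
      Adj := fun v w => M.Adj (Sum.inl v) (Sum.inl w)
      adj_sub := fun {v w} h => (graphJoin_adj_inl_inl G H v w).1 (M.adj_sub h)
      edge_vert := fun {v w} h => ⟨w, h⟩
      symm := ⟨fun v w h => SimpleGraph.Subgraph.Adj.symm h⟩ }
  have hN : N.IsMatching := by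
    rintro v ⟨w, hw⟩
    exact ⟨w, hw, fun u hu => Sum.inl_injective (hM.1.eq_of_adj_left hu hw)⟩
  have hcompl : (N.vertsᶜ).ncard ≤ Fintype.card W := by
    have hp : ∀ v ∈ N.vertsᶜ, ∃ w, M.Adj (Sum.inl v) (Sum.inr w) := by
      intro v hv
      obtain ⟨w | w, hw, -⟩ := hM.1 (hM.2 (Sum.inl v))
      · exact absurd ⟨w, hw⟩ hv
      · exact ⟨w, hw⟩
    choose p hp using hp
    rw [← Nat.card_eq_fintype_card, ← Nat.card_coe_set_eq]
    refine Nat.card_le_card_of_injective (fun v : ↥N.vertsᶜ => p v.1 v.2) ?_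
    intro v w hvw
    have h1 := hp v.1 v.2
    rw [show p v.1 v.2 = p w.1 w.2 from hvw] at h1
    exact Subtype.ext (Sum.inl_injective (hM.1.eq_of_adj_right h1 (hp w.1 w.2)))
  have h1 := Set.ncard_add_ncard_compl N.verts
  rw [Nat.card_eq_fintype_card] at h1
  have h2 := ncard_verts_le_of_isMatching hN
  have h3 := ncard_edgeSet_le_matchingNumber hN
  omega

/-- The nontrivial direction of the Tutte–Berge formula, with the components of `G - S` given as
the fibres of a colouring. -/
theorem exists_coloring_of_matchingNumber {V : Type u} [Fintype V] (G : SimpleGraph V) (d : ℕ)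
    (hd : 2 * matchingNumber G + d < Fintype.card V) (hpar : Even (Fintype.card V + d)) :
    ∃ (C : Type u) (_ : Fintype C) (S : Finset V) (c : V → C),
      (∀ v w, v ∉ S → w ∉ S → G.Adj v w → c v = c w) ∧
      S.card + d + 2 ≤
        (Finset.univ.filter fun k =>
          Odd (Finset.univ.filter fun v => v ∉ S ∧ c v = k).card).card := by
  have hfree : ¬ ∃ M : (graphJoin G (⊤ : SimpleGraph (Fin d))).Subgraph,
      M.IsPerfectMatching := by
    rintro ⟨M, hM⟩
    have := card_le_of_isPerfectMatching_graphJoin G _ hM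
    rw [Fintype.card_fin] at this
    omega
  rw [SimpleGraph.tutte] at hfree
  push Not at hfree
  obtain ⟨U, hU⟩ := hfree
  set K := ((⊤ : (graphJoin G (⊤ : SimpleGraph (Fin d))).Subgraph).deleteVerts U).coe with hK
  change U.ncard < K.oddComponents.ncard at hU
  have hverts : ∀ x, x ∈ ((⊤ : (graphJoin G (⊤ : SimpleGraph (Fin d))).Subgraph).deleteVerts
      U).verts ↔ x ∉ U := by simp
  have hcardK : Nat.card ((⊤ : (graphJoin G (⊤ : SimpleGraph (Fin d))).Subgraph).deleteVerts
      U).verts + U.ncard = Fintype.card V + d := by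
    have : ((⊤ : (graphJoin G (⊤ : SimpleGraph (Fin d))).Subgraph).deleteVerts U).verts = Uᶜ := by
      ext x; simp
    rw [Nat.card_coe_set_eq, this, add_comm, Set.ncard_add_ncard_compl]
    simp
  have hparK := SimpleGraph.odd_ncard_oddComponents (G := K)
  have hU2 : U.ncard + 2 ≤ K.oddComponents.ncard := by grind
  have hadj : ∀ x y (hx : x ∉ U) (hy : y ∉ U), (graphJoin G (⊤ : SimpleGraph (Fin d))).Adj x y →
      K.Adj ⟨x, (hverts x).2 hx⟩ ⟨y, (hverts y).2 hy⟩ := by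
    intro x y hx hy h
    simp [hK, hx, hy, h]
  have hinr : ∀ j, Sum.inr j ∈ U := by
    intro j
    by_contra hj
    have hone : ∀ k : K.ConnectedComponent,
        k = K.connectedComponentMk ⟨Sum.inr j, (hverts _).2 hj⟩ := by
      intro k
      induction k using SimpleGraph.ConnectedComponent.ind with
      | _ x =>
        obtain ⟨x, hx⟩ := x
        by_cases h : x = Sum.inr j
        · subst h; rfl
        · refine SimpleGraph.ConnectedComponent.sound (hadj _ _ ((hverts x).1 hx) hj ?_).reachable
          cases x <;> simp_all
    have : K.oddComponents.ncard ≤ 1 :=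
      (Set.ncard_le_one_iff).2 fun _ _ => (hone _).trans (hone _).symm
    omega
  refine ⟨Option K.ConnectedComponent, Fintype.ofFinite _,
    Finset.univ.filter fun v => Sum.inl v ∈ U,
    fun v => if h : Sum.inl v ∉ U then
      some (K.connectedComponentMk ⟨Sum.inl v, (hverts _).2 h⟩) else none, ?_, ?_⟩
  · intro v w hv hw h
    simp only [Finset.mem_filter, Finset.mem_univ, true_and] at hv hw
    simp only [hv, hw, not_false_eq_true, dite_true]
    exact congrArg some <| SimpleGraph.ConnectedComponent.sound
      (hadj _ _ hv hw (by simpa using h)).reachable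
  · have hcardU : (Finset.univ.filter fun v : V => Sum.inl v ∈ U).card + d = U.ncard := by
      have : U = Sum.inl '' {v : V | Sum.inl v ∈ U} ∪ Set.range (Sum.inr : Fin d → V ⊕ Fin d) := by
        ext (x | x) <;> simp [hinr]
      conv_rhs => rw [this]
      rw [Set.ncard_union_eq, Set.ncard_image_of_injective _ Sum.inl_injective,
        ← Set.image_univ, Set.ncard_image_of_injective _ Sum.inr_injective]
      · simp [Set.ncard_eq_toFinset_card']
      · rw [Set.disjoint_left]; rintro _ ⟨x, -, rfl⟩ ⟨y, hy⟩; cases hy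
    rw [hcardU]
    refine hU2.trans ?_
    rw [← Set.ncard_coe_finset]
    refine Set.ncard_le_ncard_of_injOn some ?_ (Option.some_injective _).injOn
    intro k hk
    simp only [Finset.coe_filter, Finset.mem_univ, true_and, Set.mem_ofPred_eq]
    have hk' : Odd k.supp.ncard := hk
    convert hk' using 1
    rw [← Set.ncard_coe_finset]
    refine Set.ncard_congr (fun v hv => ⟨Sum.inl v, (hverts _).2 ?_⟩) ?_ ?_ ?_
    · simpa using (Finset.mem_filter.1 (Finset.mem_coe.1 hv)).2.1
    · intro v hv
      obtain ⟨-, h1, h2⟩ := Finset.mem_filter.1 (Finset.mem_coe.1 hv)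
      simp only [Finset.mem_filter, Finset.mem_univ, true_and] at h1
      simp only [h1, not_false_eq_true, dite_true, Option.some.injEq] at h2
      exact h2
    · intro v w _ _ h
      simpa using h
    · rintro ⟨x | x, hx⟩ hxk
      · have hx' := (hverts _).1 hx
        refine ⟨x, ?_, rfl⟩
        simp only [Finset.coe_filter, Finset.mem_univ, true_and, Finset.mem_filter,
          Set.mem_ofPred_eq, hx', not_false_eq_true, dite_true, Option.some.injEq]
        exact hxk
      · exact absurd (hinr x) ((hverts _).1 hx)

end TutteBerge

section Spectral

variable {V : Type*} [Fintype V]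

theorem adjMat_mulVec (G : SimpleGraph V) (y : V → ℝ) (v : V) :
    (adjMat G).mulVec y v = ∑ u with G.Adj v u, y u := by
  simp [Matrix.mulVec, dotProduct, adjMat, Finset.sum_filter]

theorem finite_eigenvalues (M : Matrix V V ℝ) :
    {t : ℝ | ∃ v : V → ℝ, v ≠ 0 ∧ M.mulVec v = t • v}.Finite := by
  refine (Module.End.finite_hasEigenvalue (Matrix.toLin' M)).subset ?_
  rintro t ⟨v, hv, h⟩
  exact Module.End.hasEigenvalue_of_hasEigenvector
    ⟨Module.End.mem_eigenspace_iff.2 (by rwa [Matrix.toLin'_apply]), hv⟩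

theorem exists_eigenvector_specRad [Nonempty V] (G : SimpleGraph V) :
    ∃ v : V → ℝ, v ≠ 0 ∧ (adjMat G).mulVec v = specRad (adjMat G) • v := by
  have hH : (adjMat G).IsHermitian := by
    ext i j
    simp [adjMat, SimpleGraph.adj_comm]
  refine Set.Nonempty.csSup_mem (s := {t : ℝ | ∃ v : V → ℝ, v ≠ 0 ∧
    (adjMat G).mulVec v = t • v}) ?_ (finite_eigenvalues _)
  obtain ⟨i⟩ := ‹Nonempty V›
  refine ⟨hH.eigenvalues i, _, ?_, hH.mulVec_eigenvectorBasis i⟩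
  intro h
  exact hH.eigenvectorBasis.orthonormal.ne_zero i ((WithLp.ofLp_eq_zero 2).1 h)

theorem le_specRad (G : SimpleGraph V) {t : ℝ} {v : V → ℝ} (hv : v ≠ 0)
    (h : (adjMat G).mulVec v = t • v) : t ≤ specRad (adjMat G) :=
  le_csSup (finite_eigenvalues _).bddAbove ⟨v, hv, h⟩

/-- If a positive vector `x` satisfies `A x ≤ r x`, then `r` bounds the spectral radius, and when
the bound is attained `A x = r x` holds on a nonempty union of connected components. -/
theorem specRad_le_of_forall_sum_le [Nonempty V] (G : SimpleGraph V) {x : V → ℝ} {r : ℝ}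
    (hx : ∀ v, 0 < x v) (hr : ∀ v, ∑ u with G.Adj v u, x u ≤ r * x v) :
    specRad (adjMat G) ≤ r ∧ (specRad (adjMat G) = r →
      ∃ T : Set V, T.Nonempty ∧ (∀ v ∈ T, ∑ u with G.Adj v u, x u = r * x v) ∧
        ∀ v ∈ T, ∀ u, G.Adj v u → u ∈ T) := by
  obtain ⟨y, hy0, hy⟩ := exists_eigenvector_specRad G
  set μ := specRad (adjMat G)
  obtain ⟨v₀, -, hmax⟩ := Finset.univ.exists_max_image (fun v => |y v| / x v) Finset.univ_nonempty
  set t := |y v₀| / x v₀ with ht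
  have hle : ∀ v, |y v| ≤ t * x v := fun v => (div_le_iff₀ (hx v)).1 (hmax v (Finset.mem_univ v))
  have htpos : 0 < t := by
    obtain ⟨w, hw⟩ := Function.ne_iff.1 hy0
    refine pos_of_mul_pos_left ((abs_pos.2 hw).trans_le (hle w)) (hx w).le
  have hchain : ∀ v, |μ| * |y v| ≤ ∑ u with G.Adj v u, |y u| := by
    intro v
    rw [← abs_mul]
    have := congrFun hy v
    rw [adjMat_mulVec, Pi.smul_apply, smul_eq_mul] at this
    rw [← this]
    exact Finset.abs_sum_le_sum_abs _ _
  have hsum : ∀ v, ∑ u with G.Adj v u, |y u| ≤ t * ∑ u with G.Adj v u, x u := by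
    intro v
    rw [Finset.mul_sum]
    exact Finset.sum_le_sum fun u _ => hle u
  have hv₀ : |y v₀| = t * x v₀ := by rw [ht, div_mul_cancel₀ _ (hx v₀).ne']
  have hμ : |μ| ≤ r := by
    have h1 := (hchain v₀).trans ((hsum v₀).trans (mul_le_mul_of_nonneg_left (hr v₀) htpos.le))
    rw [hv₀] at h1
    refine le_of_mul_le_mul_right ?_ (mul_pos htpos (hx v₀))
    linarith
  refine ⟨(le_abs_self μ).trans hμ, fun hμr => ?_⟩
  have habs : |μ| = r := le_antisymm hμ (hμr ▸ le_abs_self μ)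
  have heq : ∀ v, |y v| = t * x v → ∑ u with G.Adj v u, x u = r * x v ∧
      ∑ u with G.Adj v u, |y u| = ∑ u with G.Adj v u, t * x u := by
    intro v hv
    have h1 := hchain v
    have h2 := hsum v
    have h3 := hr v
    rw [habs, hv] at h1
    have h4 : r * x v ≤ ∑ u with G.Adj v u, x u := by
      refine le_of_mul_le_mul_left ?_ htpos
      linarith
    have h5 := le_antisymm h3 h4
    refine ⟨h5, ?_⟩
    rw [← Finset.mul_sum]
    rw [h5] at h2 ⊢
    linarith
  refine ⟨{v | |y v| = t * x v}, ⟨v₀, hv₀⟩, fun v hv => (heq v hv).1, fun v hv u hu => ?_⟩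
  exact (Finset.sum_eq_sum_iff_of_le fun u _ => hle u).1 (heq v hv).2 u (by simpa using hu)

end Spectral

section Counting

variable {C : Type*} [Fintype C]

theorem fiber_bounds {F : C → ℕ} {s β : ℕ}
    (hq : s + β + 2 ≤ (Finset.univ.filter fun k => Odd (F k)).card)
    (hF : ∑ k, F k + s = 3 * β + 2) :
    s ≤ β ∧ (∀ k, F k + 2 * s ≤ 2 * β + 1) ∧
      ∀ k, F k + 2 * s = 2 * β + 1 → ∀ l, l ≠ k → F l ≤ 1 := by
  have hsplit : ∀ k, F k = (if Odd (F k) then 1 else 0) + (F k - if Odd (F k) then 1 else 0) := by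
    intro k
    split_ifs with h
    · have := h.pos; omega
    · omega
  have hsum : ∑ k, F k = (Finset.univ.filter fun k => Odd (F k)).card +
      ∑ k, (F k - if Odd (F k) then 1 else 0) := by
    rw [Finset.card_filter, ← Finset.sum_add_distrib]
    exact Finset.sum_congr rfl fun k _ => hsplit k
  refine ⟨by omega, fun k => ?_, fun k hk l hl => ?_⟩
  · have h1 := Finset.single_le_sum (f := fun k => F k - if Odd (F k) then 1 else 0)
      (fun _ _ => Nat.zero_le _) (Finset.mem_univ k)
    split_ifs at h1 <;> omega
  · have h1 := Finset.add_le_sum (f := fun k => F k - if Odd (F k) then 1 else 0)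
      (fun _ _ => Nat.zero_le _) (Finset.mem_univ k) (Finset.mem_univ l) hl.symm
    have hodd : Odd (F k) := by rw [Nat.odd_iff]; omega
    rw [if_pos hodd] at h1
    split_ifs at h1 <;> omega

theorem sum_weight_le {F : C → ℕ} {s β : ℕ} {σ : ℝ} (h1 : σ ≤ 1 / 2)
    (hq : s + β + 2 ≤ (Finset.univ.filter fun k => Odd (F k)).card)
    (hF : ∑ k, F k + s = 3 * β + 2) :
    ∑ k, (F k : ℝ) * (if F k = 1 then σ else 1 / 2) ≤ 3 / 2 * (β - s) + σ * (2 * s + 2) := by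
  set τ := (3 / 2 - σ) / 2 with hτ
  have hterm : ∀ k, (F k : ℝ) * (if F k = 1 then σ else 1 / 2) ≤
      τ * F k + (if Odd (F k) then 1 else 0) * (σ - τ) := by
    intro k
    by_cases hk1 : F k = 1
    · simp [hk1]
    · rw [if_neg hk1]
      by_cases hodd : Odd (F k)
      · have h3 : (3 : ℝ) ≤ F k := by
          have : 3 ≤ F k := by obtain ⟨m, hm⟩ := hodd; omega
          exact_mod_cast this
        rw [if_pos hodd]
        nlinarith
      · rw [if_neg hodd]
        have : (0 : ℝ) ≤ F k := Nat.cast_nonneg _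
        nlinarith
  refine (Finset.sum_le_sum fun k _ => hterm k).trans ?_
  rw [Finset.sum_add_distrib, ← Finset.mul_sum, ← Finset.sum_mul, ← Finset.natCast_card_filter]
  have hF' : ∑ k, (F k : ℝ) = 3 * β + 2 - s := by
    have : ((∑ k, F k + s : ℕ) : ℝ) = ((3 * β + 2 : ℕ) : ℝ) := by rw [hF]
    push_cast at this
    linarith
  have hq' : (s + β + 2 : ℝ) ≤ ((Finset.univ.filter fun k => Odd (F k)).card : ℝ) := by
    exact_mod_cast hq
  rw [hF']
  have hστ : σ - τ ≤ 0 := by linarith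
  nlinarith [mul_le_mul_of_nonpos_right hq' hστ]

end Counting

section Isomorphisms

variable {n k : ℕ}

theorem exists_equiv_sum (D : Finset (Fin n)) (hD : D.card = k) :
    ∃ e : Fin n ≃ Fin k ⊕ Fin (n - k), ∀ v, v ∈ D ↔ ∃ i, e v = Sum.inl i := by
  have h1 : Fintype.card {v // v ∈ D} = k := by simpa using hD
  have h2 : Fintype.card {v // v ∉ D} = n - k := by
    rw [Fintype.card_subtype_compl, h1, Fintype.card_fin]
  refine ⟨(Equiv.sumCompl (· ∈ D)).symm.trans
    (Equiv.sumCongr (Fintype.equivFinOfCardEq h1) (Fintype.equivFinOfCardEq h2)), fun v => ?_⟩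
  by_cases hv : v ∈ D
  · simp [Equiv.sumCompl_symm_apply_of_pos, hv]
  · simp [Equiv.sumCompl_symm_apply_of_neg, hv]

theorem nonempty_iso_graphSum (G : SimpleGraph (Fin n)) (D : Finset (Fin n)) (hD : D.card = k)
    (h : ∀ u w, G.Adj u w ↔ u ≠ w ∧ u ∈ D ∧ w ∈ D) :
    Nonempty (G ≃g graphSum (⊤ : SimpleGraph (Fin k)) (⊥ : SimpleGraph (Fin (n - k)))) := by
  obtain ⟨e, he⟩ := exists_equiv_sum D hD
  refine ⟨⟨e, fun {u w} => ?_⟩⟩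
  rw [h, he, he, ← e.injective.ne_iff]
  generalize e u = a
  generalize e w = b
  cases a <;> cases b <;> simp

theorem nonempty_iso_graphJoin (G : SimpleGraph (Fin n)) (D : Finset (Fin n)) (hD : D.card = k)
    (h : ∀ u w, G.Adj u w ↔ u ≠ w ∧ (u ∈ D ∨ w ∈ D)) :
    Nonempty (G ≃g graphJoin (⊤ : SimpleGraph (Fin k)) (⊥ : SimpleGraph (Fin (n - k)))) := by
  obtain ⟨e, he⟩ := exists_equiv_sum D hD
  refine ⟨⟨e, fun {u w} => ?_⟩⟩
  rw [h, he, he, ← e.injective.ne_iff]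
  generalize e u = a
  generalize e w = b
  cases a <;> cases b <;> simp

theorem le_specRad_of_iso {V W : Type*} [Fintype V] [Fintype W] {G : SimpleGraph V}
    {H : SimpleGraph W} (e : G ≃g H) {x : W → ℝ} {r : ℝ} (hx : x ≠ 0)
    (h : ∀ v, ∑ u with H.Adj v u, x u = r * x v) : r ≤ specRad (adjMat G) := by
  refine le_specRad G (v := x ∘ e) (fun h0 => hx ?_) ?_
  · ext w
    simpa using congrFun h0 (e.symm w)
  · ext v
    rw [adjMat_mulVec, Pi.smul_apply, smul_eq_mul, Function.comp_apply, ← h (e v)]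
    refine Finset.sum_equiv e.toEquiv (fun u => ?_) fun u _ => rfl
    simpa using e.map_adj_iff.symm

theorem sum_ite_eq_zero_else (v : Fin k) (a : ℝ) :
    ∑ x, (if v = x then 0 else a) = (k - 1) * a := by
  have : ∀ x, (if v = x then 0 else a) = a - if v = x then a else 0 := by
    intro x; split_ifs <;> simp
  simp only [this, Finset.sum_sub_distrib]
  simp
  ring

theorem le_specRad_of_iso_graphSum {V W : Type*} [Fintype V] [Fintype W] {G : SimpleGraph V}
    {β : ℕ} (e : G ≃g graphSum (⊤ : SimpleGraph (Fin (2 * β + 1))) (⊥ : SimpleGraph W)) :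
    2 * β ≤ specRad (adjMat G) := by
  refine le_specRad_of_iso e (x := Sum.elim (fun _ => 1) fun _ => 0) ?_ ?_
  · intro h
    simpa using congrFun h (Sum.inl 0)
  · rintro (v | v)
    · rw [Finset.sum_filter, Fintype.sum_sum_type]
      simp [sum_ite_eq_zero_else]
    · rw [Finset.sum_filter, Fintype.sum_sum_type]
      simp

theorem le_specRad_of_iso_graphJoin {V : Type*} [Fintype V] {G : SimpleGraph V} {β m : ℕ}
    (hm : m = 2 * β + 2)
    (e : G ≃g graphJoin (⊤ : SimpleGraph (Fin β)) (⊥ : SimpleGraph (Fin m))) :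
    2 * β ≤ specRad (adjMat G) := by
  subst hm
  refine le_specRad_of_iso e (x := Sum.elim (fun _ => 2) fun _ => 1) ?_ ?_
  · intro h
    simpa using congrFun h (Sum.inr 0)
  · rintro (v | v)
    · rw [Finset.sum_filter, Fintype.sum_sum_type]
      simp [sum_ite_eq_zero_else]
      ring
    · rw [Finset.sum_filter, Fintype.sum_sum_type]
      simp
      ring

end Isomorphisms

section Bounds

variable {n β : ℕ} {C : Type*} {G : SimpleGraph (Fin n)} {c : Fin n → C}

theorem specRad_le_of_coloring (hn : n = 3 * β + 2) (hadj : ∀ v w, G.Adj v w → c v = c w)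
    (hle : ∀ k, (Finset.univ.filter fun v => c v = k).card ≤ 2 * β + 1)
    (hother : ∀ k, (Finset.univ.filter fun v => c v = k).card = 2 * β + 1 →
      ∀ l, l ≠ k → (Finset.univ.filter fun v => c v = l).card ≤ 1) :
    specRad (adjMat G) ≤ 2 * β ∧ (specRad (adjMat G) = 2 * β →
      Nonempty (G ≃g graphSum (⊤ : SimpleGraph (Fin (2 * β + 1)))
        (⊥ : SimpleGraph (Fin (n - (2 * β + 1)))))) := by
  have : Nonempty (Fin n) := ⟨⟨0, by omega⟩⟩
  have hsub : ∀ v, (Finset.univ.filter fun u => G.Adj v u) ⊆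
      (Finset.univ.filter fun u => c u = c v).erase v := by
    intro v u hu
    simp only [Finset.mem_filter, Finset.mem_univ, true_and, Finset.mem_erase] at hu ⊢
    exact ⟨hu.ne', (hadj _ _ hu).symm⟩
  have hcard : ∀ v, ((Finset.univ.filter fun u => c u = c v).erase v).card + 1 =
      (Finset.univ.filter fun u => c u = c v).card :=
    fun v => Finset.card_erase_add_one (by simp)
  obtain ⟨h1, h2⟩ := specRad_le_of_forall_sum_le G (x := fun _ => 1) (r := 2 * β)
    (fun _ => one_pos) (by
      intro v
      have h1 := Finset.card_le_card (hsub v)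
      have h2 := hcard v
      have h3 := hle (c v)
      rw [Finset.sum_const, nsmul_eq_mul]
      have : (Finset.univ.filter fun u => G.Adj v u).card ≤ 2 * β := by omega
      simpa using (by exact_mod_cast this :
        (((Finset.univ.filter fun u => G.Adj v u).card : ℕ) : ℝ) ≤ 2 * β))
  refine ⟨h1, fun h => ?_⟩
  obtain ⟨T, ⟨v, hvT⟩, htight, hclosed⟩ := h2 h
  have hnbr : ∀ u ∈ T, (Finset.univ.filter fun w => c w = c u).card = 2 * β + 1 ∧
      (Finset.univ.filter fun w => G.Adj u w) =
        (Finset.univ.filter fun w => c w = c u).erase u := by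
    intro u hu
    have h0 := htight u hu
    rw [Finset.sum_const, nsmul_eq_mul, mul_one, mul_one] at h0
    have h0' : (Finset.univ.filter fun w => G.Adj u w).card = 2 * β := by exact_mod_cast h0
    have h1 := Finset.card_le_card (hsub u)
    have h2 := hcard u
    have h3 := hle (c u)
    exact ⟨by omega, Finset.eq_of_subset_of_card_le (hsub u) (by omega)⟩
  have hmem : ∀ u, c u = c v → u ∈ T := by
    intro u hu
    by_cases huv : u = v
    · rwa [huv]
    · refine hclosed v hvT u ?_
      have : u ∈ (Finset.univ.filter fun w => G.Adj v w) := by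
        rw [(hnbr v hvT).2]; simp [huv, hu]
      simpa using this
  refine nonempty_iso_graphSum G _ (hnbr v hvT).1 fun u w => ?_
  simp only [Finset.mem_filter, Finset.mem_univ, true_and]
  constructor
  · intro huw
    have hc := hadj _ _ huw
    suffices c u = c v from ⟨huw.ne, this, hc ▸ this⟩
    by_contra hne
    exact huw.ne (Finset.card_le_one.1 (hother _ (hnbr v hvT).1 _ hne) u (by simp) w (by simp [hc]))
  · rintro ⟨huw, hu, hw⟩
    have : w ∈ (Finset.univ.filter fun w => G.Adj u w) := by
      rw [(hnbr u (hmem u hu)).2]; simp [huw.symm, hu, hw]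
    simpa using this

theorem specRad_le_of_coloring_compl [Fintype C] {S : Finset (Fin n)} (hS : S.Nonempty)
    (hn : n = 3 * β + 2)
    (hadj : ∀ v w, v ∉ S → w ∉ S → G.Adj v w → c v = c w)
    (hq : S.card + β + 2 ≤ (Finset.univ.filter fun k =>
      Odd (Finset.univ.filter fun v => v ∉ S ∧ c v = k).card).card)
    (hF : ∑ k, (Finset.univ.filter fun v => v ∉ S ∧ c v = k).card + S.card = 3 * β + 2) :
    specRad (adjMat G) ≤ 2 * β ∧ (specRad (adjMat G) = 2 * β →
      Nonempty (G ≃g graphJoin (⊤ : SimpleGraph (Fin β)) (⊥ : SimpleGraph (Fin (n - β))))) := by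
  have : Nonempty (Fin n) := ⟨⟨0, by omega⟩⟩
  set F : C → ℕ := fun k => (Finset.univ.filter fun v => v ∉ S ∧ c v = k).card with hFdef
  obtain ⟨hsβ, hFle, -⟩ := fiber_bounds (F := F) hq hF
  have hs1 : 1 ≤ S.card := hS.card_pos
  have hs1' : (1 : ℝ) ≤ S.card := by exact_mod_cast hs1
  have hsβ' : (S.card : ℝ) ≤ β := by exact_mod_cast hsβ
  have hβ : (0 : ℝ) < β := by linarith
  set σ : ℝ := S.card / (2 * β) with hσ
  have hσβ : σ * (2 * β) = S.card := div_mul_cancel₀ _ (by positivity)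
  have hσ0 : 0 < σ := by positivity
  have hσ1 : σ ≤ 1 / 2 := by rw [hσ, div_le_div_iff₀ (by positivity) two_pos]; linarith
  set b : ℕ → ℝ := fun m => if m = 1 then σ else 1 / 2 with hb
  have hb0 : ∀ m, 0 < b m := by
    intro m; simp only [hb]; split_ifs <;> positivity
  set x : Fin n → ℝ := fun v => if v ∈ S then 1 else b (F (c v)) with hx
  have hx0 : ∀ v, 0 < x v := by
    intro v; simp only [hx]; split_ifs
    · exact one_pos
    · exact hb0 _
  have hFpos : ∀ v ∉ S, 1 ≤ F (c v) := fun v hv => Finset.card_pos.2 ⟨v, by simp [hv]⟩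
  have hout : ∀ v ∉ S, ∑ u with G.Adj v u ∧ u ∉ S, x u ≤ (F (c v) - 1) * b (F (c v)) := by
    intro v hv
    have h1 : ∀ u ∈ (Finset.univ.filter fun u => u ∉ S ∧ c u = c v).erase v,
        x u = b (F (c v)) := by
      intro u hu
      simp only [Finset.mem_erase, Finset.mem_filter, Finset.mem_univ, true_and] at hu
      simp only [hx, if_neg hu.2.1, hu.2.2]
    calc ∑ u with G.Adj v u ∧ u ∉ S, x u
        ≤ ∑ u ∈ (Finset.univ.filter fun u => u ∉ S ∧ c u = c v).erase v, x u := by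
          refine Finset.sum_le_sum_of_subset_of_nonneg ?_ fun u _ _ => (hx0 u).le
          intro u hu
          simp only [Finset.mem_erase, Finset.mem_filter, Finset.mem_univ, true_and] at hu ⊢
          exact ⟨hu.1.ne', hu.2, (hadj _ _ hv hu.2 hu.1).symm⟩
      _ = (F (c v) - 1) * b (F (c v)) := by
          rw [Finset.sum_congr rfl h1, Finset.sum_const, nsmul_eq_mul,
            Finset.card_erase_of_mem (by simp [hv]), Nat.cast_sub (hFpos v hv), Nat.cast_one]
  have hslack : ∀ v ∉ S, S.card + (F (c v) - 1) * b (F (c v)) ≤ 2 * β * b (F (c v)) := by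
    intro v hv
    have h1 : (F (c v) : ℝ) + 2 * S.card ≤ 2 * β + 1 := by exact_mod_cast hFle (c v)
    by_cases h : F (c v) = 1
    · simp only [hb, h]; norm_num; linarith
    · simp only [hb, if_neg h]; linarith
  have hsplit : ∀ v, ∑ u with G.Adj v u, x u =
      ∑ u with G.Adj v u ∧ u ∈ S, x u + ∑ u with G.Adj v u ∧ u ∉ S, x u := by
    intro v
    rw [← Finset.sum_filter_add_sum_filter_not _ (· ∈ S), Finset.filter_filter,
      Finset.filter_filter]
  have hrowOut : ∀ v ∉ S, ∑ u with G.Adj v u, x u ≤ 2 * β * x v := by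
    intro v hv
    have h1 : ∑ u with G.Adj v u ∧ u ∈ S, x u ≤ S.card := by
      have : ∑ u ∈ S, x u = S.card := by
        rw [Finset.sum_congr rfl fun u hu => show x u = 1 from if_pos hu]; simp
      rw [← this]
      refine Finset.sum_le_sum_of_subset_of_nonneg ?_ fun u _ _ => (hx0 u).le
      intro u hu
      exact (Finset.mem_filter.1 hu).2.2
    have h2 := hout v hv
    have h3 := hslack v hv
    rw [hsplit, show x v = b (F (c v)) from if_neg hv]
    linarith
  have htotal : ∑ u, x u ≤ S.card + (3 / 2 * (β - S.card) + σ * (2 * S.card + 2)) := by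
    rw [← Finset.sum_filter_add_sum_filter_not _ (· ∈ S)]
    refine add_le_add ?_ ?_
    · rw [Finset.sum_congr rfl fun u hu => show x u = 1 from if_pos (Finset.mem_filter.1 hu).2]
      simp
    · refine le_of_eq_of_le ?_ (sum_weight_le hσ1 hq hF)
      rw [← Finset.sum_fiberwise _ c]
      refine Finset.sum_congr rfl fun k _ => ?_
      rw [Finset.filter_filter, ← nsmul_eq_mul, ← Finset.sum_const]
      refine Finset.sum_congr rfl fun u hu => ?_
      obtain ⟨-, h1, h2⟩ := Finset.mem_filter.1 hu
      simp only [hx, if_neg h1, h2]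
      rfl
  have hkey : 2 * β * ((S.card + (3 / 2 * (β - S.card) + σ * (2 * S.card + 2)) - 1) - 2 * β) =
      ((S.card : ℝ) - β) * (2 * S.card + β + 2) := by
    linear_combination (2 * S.card + 2 : ℝ) * hσβ
  have hbound : S.card + (3 / 2 * (β - S.card) + σ * (2 * S.card + 2)) - 1 ≤ (2 * β : ℝ) := by
    have h1 : ((S.card : ℝ) - β) * (2 * S.card + β + 2) ≤ 0 :=
      mul_nonpos_of_nonpos_of_nonneg (by linarith) (by positivity)
    rw [← hkey] at h1
    have := nonpos_of_mul_nonpos_right h1 (by positivity : (0 : ℝ) < 2 * β)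
    linarith
  have herase : ∀ v ∈ S, ∑ u ∈ Finset.univ.erase v, x u = ∑ u, x u - 1 := by
    intro v hv
    rw [← Finset.sum_erase_add _ _ (Finset.mem_univ v), show x v = 1 from if_pos hv]
    ring
  have hsubErase : ∀ v, (Finset.univ.filter fun u => G.Adj v u) ⊆ Finset.univ.erase v := by
    intro v u hu
    simpa using ((Finset.mem_filter.1 hu).2).ne'
  have hle : ∀ v, ∑ u with G.Adj v u, x u ≤ ∑ u ∈ Finset.univ.erase v, x u := fun v =>
    Finset.sum_le_sum_of_subset_of_nonneg (hsubErase v) fun u _ _ => (hx0 u).le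
  obtain ⟨h1, h2⟩ := specRad_le_of_forall_sum_le G (x := x) (r := 2 * β) hx0 (by
    intro v
    by_cases hv : v ∈ S
    · have h1 := hle v
      rw [herase v hv] at h1
      rw [show x v = 1 from if_pos hv]
      linarith
    · exact hrowOut v hv)
  refine ⟨h1, fun h => ?_⟩
  obtain ⟨T, ⟨v, hvT⟩, htight, hclosed⟩ := h2 h
  obtain ⟨z, hzT, hzS⟩ : ∃ z ∈ T, z ∈ S := by
    by_contra! hno
    have hvS := hno v hvT
    have h1 := htight v hvT
    have h0 : ∑ u with G.Adj v u ∧ u ∈ S, x u = 0 := by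
      rw [Finset.filter_false_of_mem, Finset.sum_empty]
      rintro u - ⟨hu, huS⟩
      exact hno u (hclosed v hvT u hu) huS
    have h2 := hout v hvS
    have h3 := hslack v hvS
    rw [hsplit, h0, show x v = b (F (c v)) from if_neg hvS] at h1
    linarith
  have htz : ∀ u ∈ T, u ∈ S → S.card = β ∧ ∀ w, w ≠ u → G.Adj u w := by
    intro u huT huS
    have h1 := htight u huT
    rw [show x u = 1 from if_pos huS] at h1
    have h2 := hle u
    have h3 := herase u huS
    constructor
    · have h4 : (0 : ℝ) ≤ ((S.card : ℝ) - β) * (2 * S.card + β + 2) := by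
        rw [← hkey]
        exact mul_nonneg (by positivity) (by linarith)
      have h5 := nonneg_of_mul_nonneg_left h4 (by positivity)
      have h6 : (β : ℝ) ≤ S.card := by linarith
      exact le_antisymm hsβ (by exact_mod_cast h6)
    · intro w hw
      by_contra hnot
      have hlt : ∑ u' with G.Adj u u', x u' < ∑ u' ∈ Finset.univ.erase u, x u' :=
        Finset.sum_lt_sum_of_subset (hsubErase u) (i := w) (by simpa using hw) (by simpa using hnot)
          (hx0 w) fun _ _ _ => (hx0 _).le
      linarith
  have hcard := (htz z hzT hzS).1
  have hall : ∀ u, u ∈ T := by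
    intro u
    by_cases huz : u = z
    · rwa [huz]
    · exact hclosed z hzT u ((htz z hzT hzS).2 u huz)
  refine nonempty_iso_graphJoin G S hcard fun u w => ?_
  constructor
  · intro huw
    refine ⟨huw.ne, ?_⟩
    by_contra! hno
    have hc := hadj u w hno.1 hno.2 huw
    have h1 : F (c u) ≤ 1 := by have := hFle (c u); omega
    exact huw.ne (Finset.card_le_one.1 h1 u (by simp [hno.1]) w (by simp [hno.2, hc]))
  · rintro ⟨huw, hu | hw⟩
    · exact (htz u (hall u) hu).2 w huw.symm
    · exact ((htz w (hall w) hw).2 u huw).symm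

end Bounds

theorem stmt6 (n β : ℕ) (G : SimpleGraph (Fin n))
    (hβ : matchingNumber G = β) (h2 : n = 3 * β + 2) :
    specRad (adjMat G) ≤ 2 * β ∧
      (specRad (adjMat G) = 2 * β ↔
        (Nonempty (G ≃g graphJoin (⊤ : SimpleGraph (Fin β))
            (⊥ : SimpleGraph (Fin (n - β)))) ∨
          Nonempty (G ≃g graphSum (⊤ : SimpleGraph (Fin (2 * β + 1)))
            (⊥ : SimpleGraph (Fin (n - (2 * β + 1))))))) := by
  obtain ⟨C, _, S, c, hadj, hq'⟩ := exists_coloring_of_matchingNumber G β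
    (by rw [hβ, Fintype.card_fin]; omega)
    (by rw [Fintype.card_fin, h2]; exact ⟨2 * β + 1, by ring⟩)
  have hq : S.card + β + 2 ≤ (Finset.univ.filter fun k =>
      Odd (Finset.univ.filter fun v => v ∉ S ∧ c v = k).card).card := by
    convert hq'
  have hF : ∑ k, (Finset.univ.filter fun v => v ∉ S ∧ c v = k).card + S.card = 3 * β + 2 := by
    have h1 := Finset.card_eq_sum_card_fiberwise (f := c) (s := Sᶜ) (t := Finset.univ)
      fun _ _ => Finset.mem_coe.2 (Finset.mem_univ _)
    have h3 : ∀ k, (Finset.univ.filter fun v => v ∉ S ∧ c v = k) = Sᶜ.filter fun v => c v = k := by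
      intro k; ext v; simp
    simp only [h3]
    rw [← h1, Finset.card_compl_add_card, Fintype.card_fin, h2]
  have hmain : specRad (adjMat G) ≤ 2 * β ∧ (specRad (adjMat G) = 2 * β →
      (Nonempty (G ≃g graphJoin (⊤ : SimpleGraph (Fin β))
            (⊥ : SimpleGraph (Fin (n - β)))) ∨
          Nonempty (G ≃g graphSum (⊤ : SimpleGraph (Fin (2 * β + 1)))
            (⊥ : SimpleGraph (Fin (n - (2 * β + 1))))))) := by
    obtain rfl | hS := S.eq_empty_or_nonempty
    · have hfiber : ∀ k, (Finset.univ.filter fun v => v ∉ (∅ : Finset (Fin n)) ∧ c v = k).card =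
          (Finset.univ.filter fun v => c v = k).card := by
        intro k; congr 1; ext v; simp
      obtain ⟨-, hle, hother⟩ := fiber_bounds hq hF
      simp only [hfiber, Finset.card_empty, mul_zero, add_zero] at hle hother
      have h := specRad_le_of_coloring h2
        (fun v w => hadj v w (Finset.notMem_empty v) (Finset.notMem_empty w)) hle hother
      exact ⟨h.1, fun heq => Or.inr (h.2 heq)⟩
    · have h := specRad_le_of_coloring_compl hS h2 hadj hq hF
      exact ⟨h.1, fun heq => Or.inl (h.2 heq)⟩
  refine ⟨hmain.1, hmain.2, ?_⟩
  rintro (⟨⟨e⟩⟩ | ⟨⟨e⟩⟩)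
  · exact le_antisymm hmain.1 (le_specRad_of_iso_graphJoin (by omega) e)
  · exact le_antisymm hmain.1 (le_specRad_of_iso_graphSum e)
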